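/- Let μ > 0, ε ≥ 0, and α ∈ (0,1). Then Φ(Φ⁻¹(1 − α) − μ) ≥ max{0, 1 − δ_μ(ε) − e^ε·α, e^{−ε}·(1 − δ_μ(ε) − α)}, where δ_μ(ε) = Φ(−ε/μ + μ/2) − e^ε·Φ(−ε/μ − μ/2); that is, the μ-GDP trade-off function dominates the (ε, δ_μ(ε))-DP trade-off function pointwise. -/

import Mathlib

open MeasureTheory ProbabilityTheory Real

/-- The standard normal cumulative distribution function `Φ`. -/
noncomputable def Phi (x : ℝ) : ℝ := ((gaussianReal 0 1) (Set.Iic x)).toReal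

/-- The inverse `Φ⁻¹` of the standard normal CDF (on `(0,1)`). -/
noncomputable def PhiInv : ℝ → ℝ := Function.invFun Phi

theorem Phi_eq_integral (x : ℝ) : Phi x = ∫ t in Set.Iic x, gaussianPDFReal 0 1 t := by
  rw [Phi, gaussianReal_apply_eq_integral 0 one_ne_zero, ENNReal.toReal_ofReal]
  exact integral_nonneg fun t => gaussianPDFReal_nonneg 0 1 t

theorem continuous_gaussianPDFReal_zero_one : Continuous (gaussianPDFReal 0 1) := by
  rw [gaussianPDFReal_def]
  fun_prop

theorem hasDerivAt_Phi (x : ℝ) : HasDerivAt Phi (gaussianPDFReal 0 1 x) x := by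
  have hint := integrable_gaussianPDFReal 0 1
  have hcont := continuous_gaussianPDFReal_zero_one
  have heq : Phi = fun y => Phi 0 + ∫ t in (0 : ℝ)..y, gaussianPDFReal 0 1 t := by
    funext y
    rw [← intervalIntegral.integral_Iic_sub_Iic hint.integrableOn hint.integrableOn,
      Phi_eq_integral, Phi_eq_integral]
    ring
  rw [heq]
  exact (intervalIntegral.integral_hasDerivAt_right (hcont.intervalIntegrable _ _)
    (hcont.stronglyMeasurableAtFilter _ _) hcont.continuousAt).const_add _

theorem Phi_nonneg (x : ℝ) : 0 ≤ Phi x := ENNReal.toReal_nonneg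

theorem continuous_Phi : Continuous Phi :=
  continuous_iff_continuousAt.2 fun x => (hasDerivAt_Phi x).continuousAt

theorem Phi_eq_cdf : Phi = cdf (gaussianReal 0 1) := by
  funext x
  rw [cdf_eq_real]
  rfl

theorem Phi_PhiInv {p : ℝ} (hp : p ∈ Set.Ioo (0 : ℝ) 1) : Phi (PhiInv p) = p := by
  refine Function.invFun_eq (f := Phi) ?_
  have hbot := tendsto_cdf_atBot (gaussianReal 0 1)
  have htop := tendsto_cdf_atTop (gaussianReal 0 1)
  rw [← Phi_eq_cdf] at hbot htop
  obtain ⟨a, ha⟩ := (hbot.eventually (eventually_le_nhds hp.1)).exists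
  obtain ⟨b, hb⟩ := (htop.eventually (eventually_ge_nhds hp.2)).exists
  exact mem_range_of_exists_le_of_exists_ge continuous_Phi ⟨a, ha⟩ ⟨b, hb⟩

theorem Phi_neg (x : ℝ) : Phi (-x) = 1 - Phi x := by
  have := nullSingletonClass_gaussianReal (μ := 0) (v := 1) one_ne_zero
  have h : (gaussianReal 0 1) (Set.Iic (-x)) = (gaussianReal 0 1) (Set.Iic x)ᶜ := by
    conv_lhs => rw [← neg_zero, ← gaussianReal_map_neg,
      Measure.map_apply measurable_neg measurableSet_Iic]
    have hset : (fun y : ℝ => -y) ⁻¹' Set.Iic (-x) = Set.Ici x := by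
      ext y
      simp
    rw [hset, Set.compl_Iic]
    exact measure_congr Ioi_ae_eq_Ici.symm
  rw [Phi, Phi, h]
  exact probReal_compl_eq_one_sub measurableSet_Iic

/-- The likelihood ratio between unit-variance normals with means `μ` and `0`. -/
theorem gaussianPDFReal_sub_eq_exp_mul (μ x : ℝ) :
    gaussianPDFReal 0 1 (x - μ) = exp (μ * x - μ ^ 2 / 2) * gaussianPDFReal 0 1 x := by
  simp only [gaussianPDFReal]
  rw [mul_left_comm, ← exp_add]
  congr 2
  push_cast
  ring

/-- The Neyman–Pearson bound: the likelihood ratio test with threshold `exp c` minimizes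
the linear combination of the errors. -/
theorem Phi_sub_sub_exp_mul_Phi_ge {μ : ℝ} (hμ : 0 < μ) (c x : ℝ) :
    Phi (c / μ - μ / 2) - exp c * Phi (c / μ + μ / 2) ≤ Phi (x - μ) - exp c * Phi x := by
  set x₀ := c / μ + μ / 2 with hx₀
  set g : ℝ → ℝ := fun y => Phi (y - μ) - exp c * Phi y with hg
  have hc : c = μ * x₀ - μ ^ 2 / 2 := by
    rw [hx₀]
    field_simp
    ring
  have hderiv (y : ℝ) : HasDerivAt g
      ((exp (μ * y - μ ^ 2 / 2) - exp c) * gaussianPDFReal 0 1 y) y := by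
    have h := ((hasDerivAt_Phi (y - μ)).comp_sub_const y μ).sub
      ((hasDerivAt_Phi y).const_mul (exp c))
    rw [gaussianPDFReal_sub_eq_exp_mul, ← sub_mul] at h
    exact h
  have hcont : Continuous g := continuous_iff_continuousAt.2 fun y => (hderiv y).continuousAt
  have hmin : g x₀ ≤ g x := by
    rcases le_total x₀ x with hx | hx
    · refine monotoneOn_of_deriv_nonneg (convex_Ici x₀) hcont.continuousOn
        (fun y _ => (hderiv y).differentiableAt.differentiableWithinAt) (fun y hy => ?_)
        Set.self_mem_Ici hx hx
      rw [interior_Ici] at hy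
      rw [(hderiv y).deriv]
      refine mul_nonneg (sub_nonneg.2 (exp_le_exp.2 ?_)) (gaussianPDFReal_nonneg 0 1 y)
      rw [hc]
      gcongr
      exact hy.le
    · refine antitoneOn_of_deriv_nonpos (convex_Iic x₀) hcont.continuousOn
        (fun y _ => (hderiv y).differentiableAt.differentiableWithinAt) (fun y hy => ?_)
        hx Set.self_mem_Iic hx
      rw [interior_Iic] at hy
      rw [(hderiv y).deriv]
      refine mul_nonpos_of_nonpos_of_nonneg (sub_nonpos.2 (exp_le_exp.2 ?_))
        (gaussianPDFReal_nonneg 0 1 y)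
      rw [hc]
      gcongr
      exact hy.le
  have harg : c / μ - μ / 2 = x₀ - μ := by
    rw [hx₀]
    ring
  rw [harg]
  exact hmin

/-- For `μ > 0`, `ε ≥ 0` and `α ∈ (0,1)`, the `μ`-GDP trade-off function
dominates the `(ε, δ_μ(ε))`-DP trade-off function pointwise:
`Φ(Φ⁻¹(1 - α) - μ) ≥ max {0, 1 - δ_μ(ε) - e^ε α, e^{-ε} (1 - δ_μ(ε) - α)}`, where
`δ_μ(ε) = Φ(-ε/μ + μ/2) - e^ε Φ(-ε/μ - μ/2)`. -/
theorem stmt_8 (μ ε : ℝ) (hμ : 0 < μ) (hε : 0 ≤ ε) (α : ℝ) (hα : α ∈ Set.Ioo (0 : ℝ) 1) :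
    Phi (PhiInv (1 - α) - μ) ≥
      max 0 (max
        (1 - (Phi (-ε / μ + μ / 2) - exp ε * Phi (-ε / μ - μ / 2)) - exp ε * α)
        (exp (-ε) * (1 - (Phi (-ε / μ + μ / 2) - exp ε * Phi (-ε / μ - μ / 2)) - α))) := by
  have hx : Phi (PhiInv (1 - α)) = 1 - α :=
    Phi_PhiInv ⟨sub_pos.2 hα.2, sub_lt_self 1 hα.1⟩
  set x := PhiInv (1 - α)
  refine max_le (Phi_nonneg _) (max_le ?_ ?_)
  · have h := Phi_sub_sub_exp_mul_Phi_ge hμ ε x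
    have h₁ : Phi (-ε / μ + μ / 2) = 1 - Phi (ε / μ - μ / 2) := by
      rw [← Phi_neg]
      ring_nf
    have h₂ : Phi (-ε / μ - μ / 2) = 1 - Phi (ε / μ + μ / 2) := by
      rw [← Phi_neg]
      ring_nf
    rw [hx] at h
    rw [h₁, h₂]
    linarith
  · have h := Phi_sub_sub_exp_mul_Phi_ge hμ (-ε) x
    have hexp : exp (-ε) * exp ε = 1 := by
      rw [← exp_add, neg_add_cancel, exp_zero]
    rw [hx] at h
    calc _ = exp (-ε) * (1 - α) - exp (-ε) * Phi (-ε / μ + μ / 2)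
          + exp (-ε) * exp ε * Phi (-ε / μ - μ / 2) := by ring
      _ ≤ Phi (x - μ) := by
        rw [hexp]
        linarith
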